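/- arXiv:1805.04751 — 5 statements merged into one kernel-verified Lean document; each statement's English description precedes it below -/
import Mathlib

section
/- Let k be a positive integer which is not a power of two (i.e. k ≠ 2^j for every j ≥ 0). Then there is no integer η satisfying η² · (2·h_k² − h_{2k}) = 6·h_{2k} + 1 (where this is an equation of rational numbers). (This is the arithmetic core of the theorem that a closed almost complex manifold with sum of Betti numbers three has dimension a power of two.) -/
/-- The coefficient `h_m` of `p_m` in the `m`-th Hirzebruch `L`-polynomial:
`h_m = 2^(2m) * (2^(2m-1) - 1) * |B_{2m}| / (2m)!`. -/
noncomputable def hCoeff (m : ℕ) : ℚ :=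
  2 ^ (2 * m) * (2 ^ (2 * m - 1) - 1) * |bernoulli (2 * m)| / (Nat.factorial (2 * m) : ℚ)

theorem padicValNat_two_factorial_add_two_le {n : ℕ} (hn : 0 < n) (h : ∀ j : ℕ, n ≠ 2 ^ j) :
    padicValNat 2 n.factorial + 2 ≤ n := by
  induction n using Nat.strong_induction_on with
  | _ n ih =>
    rcases Nat.even_or_odd' n with ⟨m, rfl | rfl⟩
    · have hm := ih m (by omega) (by omega) fun j hj => h (j + 1) (by rw [hj, pow_succ, mul_comm])
      have := padicValNat_factorial_mul (p := 2) m
      omega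
    · have hm : m ≠ 0 := fun hm => h 0 (by simp [hm])
      have h1 := padicValNat_factorial_mul (p := 2) m
      have h2 := padicValNat_factorial_mul_add (p := 2) (n := 1) m (by norm_num)
      have h3 := padicValNat_factorial_lt_of_ne_zero (p := 2) hm
      omega

theorem padicNorm_two_inv_natCast_prime_le {q : ℕ} (hq : q.Prime) :
    padicNorm 2 (1 / (q : ℚ)) ≤ 2 := by
  rw [padicNorm.div, padicNorm.one]
  by_cases h : q = 2
  · subst h
    rw [padicNorm.padicNorm_p_of_prime]
    norm_num
  · have := Fact.mk hq
    rw [padicNorm.padicNorm_of_prime_of_ne (Ne.symm h)]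
    norm_num

theorem padicNorm_two_bernoulli_le (m : ℕ) : padicNorm 2 (bernoulli (2 * m)) ≤ 2 := by
  obtain ⟨z, hz⟩ := Bernoulli.vonStaudt_clausen m
  have hB := eq_sub_of_add_eq hz.symm
  rw [hB]
  refine padicNorm.sub.trans (max_le ((padicNorm.of_int z).trans (by norm_num)) ?_)
  refine padicNorm.sum_le' (fun q hq => ?_) (by norm_num)
  exact padicNorm_two_inv_natCast_prime_le (Finset.mem_filter.mp hq).2.1

theorem padicNorm_abs (p : ℕ) (x : ℚ) : padicNorm p |x| = padicNorm p x := by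
  rcases abs_choice x with h | h <;> simp [h]

theorem padicNorm_two_hCoeff_le {m : ℕ} (hm : 0 < m) (h : ∀ j : ℕ, m ≠ 2 ^ j) :
    padicNorm 2 (hCoeff m) ≤ 1 / 2 := by
  have hv : padicValNat 2 (2 * m).factorial + 2 ≤ 2 * m := by
    have := padicValNat_two_factorial_add_two_le hm h
    have := padicValNat_factorial_mul (p := 2) m
    omega
  obtain ⟨d, hd⟩ := Nat.exists_eq_add_of_le hv
  have hfac : padicNorm 2 ((2 * m).factorial : ℚ) =
      (2 ^ padicValNat 2 (2 * m).factorial : ℚ)⁻¹ := by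
    rw [padicNorm.eq_zpow_of_nonzero (by positivity)]
    simp
  have hpow : padicNorm 2 ((2 : ℚ) ^ (2 * m)) = (2 ^ (2 * m) : ℚ)⁻¹ := by
    rw [padicNorm.eq_zpow_of_nonzero (by positivity), padicValRat.pow]
    have : padicValRat 2 (2 : ℚ) = 1 := padicValRat.self (p := 2) (by norm_num)
    rw [this, mul_one, zpow_neg]
    norm_cast
  have hint : padicNorm 2 ((2 : ℚ) ^ (2 * m - 1) - 1) ≤ 1 := by
    simpa using padicNorm.of_int (p := 2) (2 ^ (2 * m - 1) - 1)
  have hB := padicNorm_two_bernoulli_le m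
  rw [hCoeff, padicNorm.div, padicNorm.mul, padicNorm.mul, padicNorm_abs, hfac, hpow,
    div_inv_eq_mul]
  set v := padicValNat 2 (2 * m).factorial
  calc _ ≤ ((2 : ℚ) ^ (2 * m))⁻¹ * 1 * 2 * 2 ^ v := by
        have := padicNorm.nonneg (p := 2) (bernoulli (2 * m))
        gcongr
    _ = 1 / 2 * (2 ^ d)⁻¹ := by
        rw [hd, pow_add, pow_add]
        field_simp
    _ ≤ 1 / 2 * 1 := by
        gcongr
        exact inv_le_one_of_one_le₀ (one_le_pow₀ (by norm_num))
    _ = 1 / 2 := mul_one _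

/-- If `k` is a positive integer which is not a power of two, then there is no integer `η`
with `η² * (2 * h_k² - h_{2k}) = 6 * h_{2k} + 1`. -/
theorem no_eta_of_not_pow_two (k : ℕ) (hk : 0 < k) (h : ∀ j : ℕ, k ≠ 2 ^ j) :
    ¬ ∃ η : ℤ, (η : ℚ) ^ 2 * (2 * hCoeff k ^ 2 - hCoeff (2 * k)) = 6 * hCoeff (2 * k) + 1 := by
  rintro ⟨η, hη⟩
  have hk1 := padicNorm_two_hCoeff_le hk h
  have hk2 : padicNorm 2 (hCoeff (2 * k)) ≤ 1 / 2 := by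
    refine padicNorm_two_hCoeff_le (by omega) fun j hj => ?_
    cases j with
    | zero => omega
    | succ j => exact h j (by rw [pow_succ] at hj; omega)
  have hmul : ∀ (z : ℤ) {x : ℚ}, padicNorm 2 x ≤ 1 / 2 → padicNorm 2 (z * x) ≤ 1 / 2 := by
    intro z x hx
    rw [padicNorm.mul]
    exact (mul_le_of_le_one_left (padicNorm.nonneg _) (padicNorm.of_int z)).trans hx
  have hsq : padicNorm 2 (hCoeff k ^ 2) ≤ 1 / 2 := by
    rw [sq, padicNorm.mul]
    exact (mul_le_of_le_one_left (padicNorm.nonneg _) (hk1.trans (by norm_num))).trans hk1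
  have hone : (1 : ℚ) = ((η ^ 2 : ℤ) : ℚ) * (((2 : ℤ) : ℚ) * hCoeff k ^ 2 - hCoeff (2 * k))
      - ((6 : ℤ) : ℚ) * hCoeff (2 * k) := by
    push_cast
    linarith
  have hle : padicNorm 2 1 ≤ 1 / 2 :=
    (congrArg (padicNorm 2) hone).trans_le <| padicNorm.sub.trans
      (max_le (hmul _ (padicNorm.sub.trans (max_le (hmul 2 hsq) hk2))) (hmul 6 hk2))
  rw [padicNorm.one] at hle
  norm_num at hle
end

section
/- Let k be a positive integer and let η be an integer satisfying η² · (2·h_k² − h_{2k}) = 6·h_{2k} + 1 (an equation of rational numbers). Then η is odd. -/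
theorem mem_integer_padicValuation_two_iff {x : ℚ} :
    x ∈ (Rat.padicValuation 2).integer ↔ ¬ 2 ∣ x.den :=
  Rat.padicValuation_le_one_iff

theorem inv_natCast_mem_integer_padicValuation_two {n : ℕ} (hn : ¬ 2 ∣ n) :
    (n : ℚ)⁻¹ ∈ (Rat.padicValuation 2).integer := by
  rw [mem_integer_padicValuation_two_iff, Rat.inv_natCast_den]
  split_ifs <;> simp_all

theorem two_mul_bernoulli_mem_integer_padicValuation_two (m : ℕ) :
    2 * bernoulli (2 * m) ∈ (Rat.padicValuation 2).integer := by
  obtain ⟨n, hn⟩ := Bernoulli.vonStaudt_clausen m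
  rw [eq_sub_of_add_eq hn.symm, mul_sub, Finset.mul_sum]
  refine sub_mem (mul_mem (ofNat_mem _ 2) (intCast_mem _ n)) (sum_mem fun p hp ↦ ?_)
  obtain ⟨-, hp, -⟩ := Finset.mem_filter.mp hp
  obtain rfl | hp2 := eq_or_ne p 2
  · norm_num
  · rw [one_div]
    refine mul_mem (ofNat_mem _ 2) (inv_natCast_mem_integer_padicValuation_two fun h ↦ hp2 ?_)
    exact ((Nat.prime_dvd_prime_iff_eq Nat.prime_two hp).mp h).symm

theorem two_pow_div_factorial_mem_integer_padicValuation_two {n : ℕ} (hn : n ≠ 0) :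
    (2 ^ (n - 1) / n.factorial : ℚ) ∈ (Rat.padicValuation 2).integer := by
  obtain ⟨e, c, hc, hfac⟩ :=
    Nat.exists_eq_pow_mul_and_not_dvd n.factorial_ne_zero 2 (by norm_num)
  have hlt : padicValNat 2 n.factorial < n := padicValNat_factorial_lt_of_ne_zero 2 hn
  have hle : e ≤ padicValNat 2 n.factorial :=
    (padicValNat_dvd_iff_le n.factorial_ne_zero).mp (hfac ▸ dvd_mul_right _ _)
  obtain ⟨d, hd⟩ : ∃ d, n - 1 = e + d := ⟨n - 1 - e, by lia⟩
  have hquot : (2 ^ (n - 1) / n.factorial : ℚ) = 2 ^ d * (c : ℚ)⁻¹ := by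
    rw [hfac, hd, pow_add]
    push_cast
    rw [mul_div_mul_left _ _ (by positivity), div_eq_mul_inv]
  rw [hquot]
  exact mul_mem (pow_mem (ofNat_mem _ 2) _) (inv_natCast_mem_integer_padicValuation_two hc)

theorem hCoeff_mem_integer_padicValuation_two {m : ℕ} (hm : 0 < m) :
    hCoeff m ∈ (Rat.padicValuation 2).integer := by
  have h : hCoeff m = 2 ^ (2 * m - 1) / (2 * m).factorial * (2 ^ (2 * m - 1) - 1) *
      |2 * bernoulli (2 * m)| := by
    obtain ⟨j, hj⟩ : ∃ j, 2 * m = j + 1 := ⟨2 * m - 1, by lia⟩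
    rw [hCoeff, abs_mul, hj, Nat.add_sub_cancel, pow_succ, abs_two]
    ring
  rw [h]
  refine mul_mem (mul_mem (two_pow_div_factorial_mem_integer_padicValuation_two (by lia))
    (sub_mem (pow_mem (ofNat_mem _ 2) _) (one_mem _))) ?_
  have hB := two_mul_bernoulli_mem_integer_padicValuation_two m
  rcases abs_choice (2 * bernoulli (2 * m)) with h | h <;> rw [h]
  · exact hB
  · exact neg_mem hB

/-- If `k` is a positive integer and `η` is an integer with
`η² * (2 * h_k² - h_{2k}) = 6 * h_{2k} + 1`, then `η` is odd. -/
theorem eta_odd (k : ℕ) (hk : 0 < k) (η : ℤ)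
    (hη : (η : ℚ) ^ 2 * (2 * hCoeff k ^ 2 - hCoeff (2 * k)) = 6 * hCoeff (2 * k) + 1) :
    Odd η := by
  by_contra hodd
  obtain ⟨t, rfl⟩ := (Int.not_odd_iff_even.mp hodd).two_dvd
  have h₁ := hCoeff_mem_integer_padicValuation_two hk
  have h₂ := hCoeff_mem_integer_padicValuation_two (m := 2 * k) (by lia)
  have hhalf : (2⁻¹ : ℚ) =
      2 * t ^ 2 * (2 * hCoeff k ^ 2 - hCoeff (2 * k)) - 3 * hCoeff (2 * k) := by
    push_cast at hη
    linarith
  have hmem : (2⁻¹ : ℚ) ∈ (Rat.padicValuation 2).integer := by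
    rw [hhalf]
    exact sub_mem (mul_mem (mul_mem (ofNat_mem _ 2) (pow_mem (intCast_mem _ t) 2))
      (sub_mem (mul_mem (ofNat_mem _ 2) (pow_mem h₁ 2)) h₂)) (mul_mem (ofNat_mem _ 3) h₂)
  exact mem_integer_padicValuation_two_iff.mp hmem (by norm_num)
end

section
/- Let k be a positive integer and let η be an integer satisfying η² · (2·h_k² − h_{2k}) = 6·h_{2k} + 1 (an equation of rational numbers). Then η is not divisible by 9. -/
theorem exists_int_mul_sum_one_div_prime {q : ℕ} (hq : q.Prime) (S : Finset ℕ)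
    (hS : ∀ p ∈ S, p.Prime ∧ p ≠ q) :
    ∃ D m : ℤ, ¬ (q : ℤ) ∣ D ∧ (D : ℚ) * ∑ p ∈ S, (1 : ℚ) / p = m := by
  induction S using Finset.induction_on with
  | empty => exact ⟨1, 0, by exact_mod_cast hq.one_lt.ne' ∘ Nat.dvd_one.mp, by simp⟩
  | insert p S hp ih =>
    obtain ⟨D, m, hD, hm⟩ := ih fun r hr => hS r (Finset.mem_insert_of_mem hr)
    obtain ⟨hpp, hpq⟩ := hS p (Finset.mem_insert_self p S)
    refine ⟨D * p, D + m * p, ?_, ?_⟩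
    · intro h
      rcases (Nat.prime_iff_prime_int.mp hq).dvd_or_dvd h with h | h
      · exact hD h
      · exact hpq ((Nat.prime_dvd_prime_iff_eq hq hpp).mp (by exact_mod_cast h)).symm
    · have hp0 : (p : ℚ) ≠ 0 := by exact_mod_cast hpp.ne_zero
      rw [Finset.sum_insert hp]
      push_cast
      rw [← hm]
      field_simp

/-- The denominator of `B_{2m}` is divisible by `3` exactly once. -/
theorem exists_three_mul_bernoulli_eq (m : ℕ) (hm : 0 < m) :
    ∃ D n : ℤ, ¬ (3 : ℤ) ∣ D ∧ ¬ (3 : ℤ) ∣ n ∧ 3 * (D : ℚ) * bernoulli (2 * m) = n := by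
  obtain ⟨z, hz⟩ := Bernoulli.vonStaudt_clausen m
  have h3 : 3 ∈ (Finset.range (2 * m + 2)).filter fun p => p.Prime ∧ (p - 1) ∣ 2 * m := by
    simp only [Finset.mem_filter, Finset.mem_range]
    exact ⟨by omega, Nat.prime_three, by simp⟩
  rw [← Finset.add_sum_erase _ _ h3] at hz
  obtain ⟨D, a, hD, ha⟩ := exists_int_mul_sum_one_div_prime Nat.prime_three
    (((Finset.range (2 * m + 2)).filter fun p => p.Prime ∧ (p - 1) ∣ 2 * m).erase 3)
    fun p hp => by
      simp only [Finset.mem_erase, Finset.mem_filter] at hp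
      exact ⟨hp.2.2.1, hp.1⟩
  push_cast at hD hz
  refine ⟨D, 3 * (D * z - a) - D, hD, by omega, ?_⟩
  push_cast
  rw [← ha]
  linear_combination (-3 * (D : ℚ)) * hz

/-- The denominator of `(2m)! * h_m` is divisible by `3` exactly once. -/
theorem exists_hCoeff_eq (m : ℕ) (hm : 0 < m) :
    ∃ D n : ℤ, ¬ (3 : ℤ) ∣ D ∧ ¬ (3 : ℤ) ∣ n ∧
      3 * (D : ℚ) * (Nat.factorial (2 * m) : ℚ) * hCoeff m = n := by
  obtain ⟨D, n, hD, hn, h⟩ := exists_three_mul_bernoulli_eq m hm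
  have h2 : ¬ (3 : ℤ) ∣ 2 ^ (2 * m) := fun h => by
    have := Int.prime_three.dvd_of_dvd_pow h
    omega
  have h1 : ¬ (3 : ℤ) ∣ 2 ^ (2 * m - 1) - 1 := by
    obtain ⟨j, rfl⟩ : ∃ j, m = j + 1 := ⟨m - 1, by omega⟩
    have h4 : (3 : ℤ) ∣ 4 ^ j - 1 := by simpa using sub_dvd_pow_sub_pow (4 : ℤ) 1 j
    have : (2 : ℤ) ^ (2 * (j + 1) - 1) = 2 * 4 ^ j := by
      rw [show 2 * (j + 1) - 1 = 2 * j + 1 by omega, pow_succ, pow_mul]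
      norm_num [mul_comm]
    omega
  refine ⟨|D|, 2 ^ (2 * m) * (2 ^ (2 * m - 1) - 1) * |n|, by rwa [dvd_abs], ?_, ?_⟩
  · intro h
    rcases Int.prime_three.dvd_or_dvd h with h | h
    · exact (Int.prime_three.dvd_or_dvd h).elim h2 h1
    · exact hn ((dvd_abs _ _).mp h)
  · have hf : (Nat.factorial (2 * m) : ℚ) ≠ 0 := by exact_mod_cast Nat.factorial_ne_zero _
    push_cast
    rw [← h, abs_mul, abs_mul, hCoeff]
    field_simp
    norm_num
    ring

/-- If `k` is a positive integer and `η` is an integer with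
`η² * (2 * h_k² - h_{2k}) = 6 * h_{2k} + 1`, then `9 ∤ η`. -/
theorem eta_not_div_nine (k : ℕ) (hk : 0 < k) (η : ℤ)
    (hη : (η : ℚ) ^ 2 * (2 * hCoeff k ^ 2 - hCoeff (2 * k)) = 6 * hCoeff (2 * k) + 1) :
    ¬ (9 : ℤ) ∣ η := by
  rintro ⟨t, rfl⟩
  obtain ⟨D, U, hD, -, hU⟩ := exists_hCoeff_eq k hk
  obtain ⟨E, W, -, hW, hEW⟩ := exists_hCoeff_eq (2 * k) (by omega)
  obtain ⟨C, hC⟩ : ∃ C : ℕ, Nat.factorial (2 * (2 * k)) = Nat.factorial (2 * k) ^ 2 * C := by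
    rw [sq, two_mul (2 * k)]
    exact Nat.factorial_mul_factorial_dvd_factorial_add _ _
  obtain ⟨F, hF⟩ : 3 ∣ Nat.factorial (2 * (2 * k)) :=
    Nat.dvd_factorial (by norm_num) (by omega)
  have hCq : (Nat.factorial (2 * (2 * k)) : ℚ) = (Nat.factorial (2 * k) : ℚ) ^ 2 * C := by
    exact_mod_cast hC
  have hFq : (Nat.factorial (2 * (2 * k)) : ℚ) = 3 * F := by exact_mod_cast hF
  have key : 9 * t ^ 2 * (2 * C * E * U ^ 2 - 3 * D ^ 2 * W)
      = 2 * D ^ 2 * W + 3 * F * E * D ^ 2 := by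
    have : (9 * t ^ 2 * (2 * C * E * U ^ 2 - 3 * D ^ 2 * W) : ℚ)
        = 2 * D ^ 2 * W + 3 * F * E * D ^ 2 := by
      push_cast at hη
      rw [← hU, ← hEW, ← hFq]
      rw [hCq]
      linear_combination ((Nat.factorial (2 * k) : ℚ) ^ 2 * C * E * D ^ 2) * hη
    exact_mod_cast this
  have h3 : (3 : ℤ) ∣ 2 * (D ^ 2 * W) :=
    ⟨3 * t ^ 2 * (2 * C * E * U ^ 2 - 3 * D ^ 2 * W) - F * E * D ^ 2, by
      linear_combination -key⟩
  have h3' : (3 : ℤ) ∣ D ^ 2 * W := by omega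
  rcases Int.prime_three.dvd_or_dvd h3' with h | h
  · exact hD (Int.prime_three.dvd_of_dvd_pow h)
  · exact hW h
end

section
/- The sequence of rational numbers h_k tends to zero as k → ∞, i.e. lim_{k→∞} h_k = 0 (as a limit of real numbers). -/
/-- Euler's formula for `ζ(2k)`, compared with `ζ(2)`, bounds the even Bernoulli numbers. -/
theorem two_pow_mul_pi_pow_mul_abs_bernoulli_div_factorial_le {k : ℕ} (hk : k ≠ 0) :
    (2 : ℝ) ^ (2 * k - 1) * Real.pi ^ (2 * k) * (|(bernoulli (2 * k) : ℝ)| / (2 * k).factorial) ≤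
      Real.pi ^ 2 / 6 := by
  have h := hasSum_zeta_nat hk
  have hle := hasSum_le (fun n : ℕ => ?_) h hasSum_zeta_two
  · have hnonneg := h.nonneg fun n => by positivity
    rw [← abs_of_nonneg hnonneg] at hle
    simpa [abs_div, abs_mul, abs_pow, abs_of_pos Real.pi_pos, mul_div_assoc] using hle
  · rcases Nat.eq_zero_or_pos n with rfl | hn
    · simp [hk]
    · have hn' : (1 : ℝ) ≤ n := by exact_mod_cast hn
      gcongr
      omega

theorem hCoeff_nonneg (k : ℕ) : 0 ≤ hCoeff k := by
  have h : (1 : ℚ) ≤ 2 ^ (2 * k - 1) := one_le_pow₀ (by norm_num)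
  have h' : (0 : ℚ) ≤ 2 ^ (2 * k - 1) - 1 := sub_nonneg.mpr h
  unfold hCoeff
  positivity

theorem hCoeff_le {k : ℕ} (hk : k ≠ 0) :
    (hCoeff k : ℝ) ≤ Real.pi ^ 2 / 6 * (4 / Real.pi ^ 2) ^ k := by
  have h := two_pow_mul_pi_pow_mul_abs_bernoulli_div_factorial_le hk
  have hπ : (0 : ℝ) < Real.pi ^ (2 * k) := by positivity
  calc (hCoeff k : ℝ)
      = 2 ^ (2 * k) * (2 ^ (2 * k - 1) - 1) *
          (|(bernoulli (2 * k) : ℝ)| / (2 * k).factorial) := by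
        simp [hCoeff, mul_div_assoc]
    _ ≤ 2 ^ (2 * k) * 2 ^ (2 * k - 1) * (|(bernoulli (2 * k) : ℝ)| / (2 * k).factorial) := by
        gcongr
        linarith
    _ = 2 ^ (2 * k) / Real.pi ^ (2 * k) * (2 ^ (2 * k - 1) * Real.pi ^ (2 * k) *
          (|(bernoulli (2 * k) : ℝ)| / (2 * k).factorial)) := by
        field_simp
    _ ≤ 2 ^ (2 * k) / Real.pi ^ (2 * k) * (Real.pi ^ 2 / 6) := by gcongr
    _ = Real.pi ^ 2 / 6 * (4 / Real.pi ^ 2) ^ k := by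
        rw [div_pow, ← pow_mul, pow_mul 2 2 k]
        norm_num
        ring

/-- The coefficients `h_k` tend to zero as `k → ∞` (as real numbers). -/
theorem hCoeff_tendsto_zero :
    Filter.Tendsto (fun k : ℕ => (hCoeff k : ℝ)) Filter.atTop (nhds 0) := by
  have hlt : 4 / Real.pi ^ 2 < 1 := by
    rw [div_lt_one (by positivity)]
    nlinarith [Real.pi_gt_three]
  have hlim : Filter.Tendsto (fun k : ℕ => Real.pi ^ 2 / 6 * (4 / Real.pi ^ 2) ^ k)
      Filter.atTop (nhds 0) := by
    simpa using (tendsto_pow_atTop_nhds_zero_of_lt_one (by positivity) hlt).const_mul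
      (Real.pi ^ 2 / 6)
  refine tendsto_of_tendsto_of_tendsto_of_le_of_le' tendsto_const_nhds hlim
    (Filter.Eventually.of_forall fun k => ?_) ?_
  · exact_mod_cast hCoeff_nonneg k
  · filter_upwards [Filter.eventually_ne_atTop 0] with k hk using hCoeff_le hk
end

section
/- For every k in the set {1, 2, 4, 8, 16, 32, 64, 128}, there is no integer η satisfying η² · (2·h_k² − h_{2k}) = 6·h_{2k} + 1 (an equation of rational numbers). (Consequently, there are no almost complex manifolds in dimensions between 8 and 1024 whose sum of Betti numbers is three.) -/
open PowerSeries in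
/-- The power series of `x / sinh x`, written as `2 B(x) - B(2x)` with `B(x) = x / (exp x - 1)`. -/
noncomputable def cosechSeries : PowerSeries ℚ :=
  2 * bernoulliPowerSeries ℚ - rescale (2 : ℚ) (bernoulliPowerSeries ℚ)

/-- The coefficient of `x ^ (2 * n)` in `x / sinh x`. -/
noncomputable def cosechCoeff (n : ℕ) : ℚ :=
  PowerSeries.coeff (2 * n) cosechSeries

open PowerSeries in
theorem coeff_cosechSeries (n : ℕ) :
    coeff n cosechSeries = (2 - 2 ^ n) * (bernoulli n / (n.factorial : ℚ)) := by
  have h2 : (2 : PowerSeries ℚ) = C (2 : ℚ) := (map_ofNat C 2).symm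
  rw [cosechSeries, map_sub, coeff_rescale, h2, coeff_C_mul]
  simp only [bernoulliPowerSeries, coeff_mk, Algebra.algebraMap_self, RingHom.id_apply]
  ring

theorem coeff_cosechSeries_of_odd {n : ℕ} (hn : Odd n) :
    PowerSeries.coeff n cosechSeries = 0 := by
  rw [coeff_cosechSeries]
  rcases eq_or_ne n 1 with rfl | h1
  · norm_num
  · rw [bernoulli_eq_zero_of_odd hn (by have := hn.pos; omega)]
    simp

open PowerSeries in
theorem cosechSeries_mul_exp_sub_exp_neg :
    cosechSeries * (exp ℚ - evalNegHom (exp ℚ)) = 2 * X := by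
  have hB := bernoulliPowerSeries_mul_exp_sub_one ℚ
  have hsq : rescale (2 : ℚ) (exp ℚ) = exp ℚ ^ 2 := by
    have := exp_pow_eq_rescale_exp (A := ℚ) 2
    simpa using this.symm
  have hB2 : rescale (2 : ℚ) (bernoulliPowerSeries ℚ) * (exp ℚ ^ 2 - 1) = 2 * X := by
    have := congrArg (rescale (2 : ℚ)) hB
    rw [map_mul, map_sub, map_one, hsq, rescale_X] at this
    simpa [map_ofNat] using this
  have hE := exp_mul_exp_neg_eq_one (A := ℚ)
  rw [cosechSeries]
  linear_combination (2 * (exp ℚ + 1) * evalNegHom (exp ℚ)) * hB - evalNegHom (exp ℚ) * hB2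
    + (2 * X + (rescale (2 : ℚ) (bernoulliPowerSeries ℚ) - 2 * bernoulliPowerSeries ℚ) * exp ℚ) * hE

theorem cosechCoeff_zero : cosechCoeff 0 = 1 := by
  rw [cosechCoeff, coeff_cosechSeries]
  norm_num

open PowerSeries in
/-- The recurrence expressing `(x / sinh x) * (sinh x / x) = 1`. -/
theorem sum_cosechCoeff_div_factorial {m : ℕ} (hm : m ≠ 0) :
    ∑ i ∈ Finset.range (m + 1), cosechCoeff i / ((2 * (m - i) + 1).factorial : ℚ) = 0 := by
  have h := congrArg (coeff (2 * m + 1)) cosechSeries_mul_exp_sub_exp_neg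
  have h2 : (2 : PowerSeries ℚ) = C (2 : ℚ) := (map_ofNat C 2).symm
  rw [h2, coeff_C_mul, coeff_X, if_neg (by omega), mul_zero, coeff_mul,
    Finset.Nat.sum_antidiagonal_eq_sum_range_succ_mk] at h
  have hodd : ∀ i ∈ Finset.range (2 * m + 1).succ, i ∉ (Finset.range (m + 1)).image (2 * ·) →
      coeff i cosechSeries * coeff (2 * m + 1 - i) (exp ℚ - evalNegHom (exp ℚ)) = 0 := by
    intro i hi hi'
    rw [coeff_cosechSeries_of_odd, zero_mul]
    rw [← Nat.not_even_iff_odd]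
    rintro ⟨j, rfl⟩
    apply hi'
    simp only [Finset.mem_range, Finset.mem_image] at hi ⊢
    exact ⟨j, by omega, by omega⟩
  rw [← Finset.sum_subset (s₁ := (Finset.range (m + 1)).image (2 * ·)) _ hodd,
    Finset.sum_image (by intro a _ b _ hab; simpa using hab)] at h
  · have key : ∀ i ∈ Finset.range (m + 1),
        coeff (2 * i) cosechSeries * coeff (2 * m + 1 - 2 * i) (exp ℚ - evalNegHom (exp ℚ)) =
          2 * (cosechCoeff i / ((2 * (m - i) + 1).factorial : ℚ)) := by
      intro i hi
      have hi' : 2 * m + 1 - 2 * i = 2 * (m - i) + 1 := by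
        have := Finset.mem_range.1 hi
        omega
      rw [hi', map_sub, evalNegHom, coeff_rescale, coeff_exp, pow_succ, pow_mul, cosechCoeff]
      simp only [Algebra.algebraMap_self, RingHom.id_apply]
      norm_num
      ring
    rw [Finset.sum_congr rfl key, ← Finset.mul_sum] at h
    simpa using h
  · intro i hi
    simp only [Finset.mem_range, Finset.mem_image] at hi ⊢
    obtain ⟨j, hj, rfl⟩ := hi
    omega

theorem hCoeff_sq {k : ℕ} (hk : k ≠ 0) :
    hCoeff k ^ 2 = 2 ^ (4 * k - 2) * cosechCoeff k ^ 2 := by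
  obtain ⟨n, rfl⟩ := Nat.exists_eq_succ_of_ne_zero hk
  rw [hCoeff, cosechCoeff, coeff_cosechSeries, div_pow, mul_pow, sq_abs]
  rw [show 4 * n.succ - 2 = (2 * n + 1) * 2 by omega, show 2 * n.succ - 1 = 2 * n + 1 by omega,
    show 2 * n.succ = 2 * n + 1 + 1 by omega, pow_mul, pow_succ (2 : ℚ) (2 * n + 1)]
  ring

theorem bernoulli_four_mul_neg {k : ℕ} (hk : k ≠ 0) : bernoulli (2 * (2 * k)) < 0 := by
  have h := hasSum_zeta_nat (k := 2 * k) (by omega)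
  have hpos : (0 : ℝ) < ∑' n : ℕ, 1 / (n : ℝ) ^ (2 * (2 * k)) :=
    h.summable.tsum_pos (fun n => by positivity) 1 (by simp)
  rw [h.tsum_eq] at hpos
  by_contra! hneg
  have hneg' : (0 : ℝ) ≤ (bernoulli (2 * (2 * k)) : ℝ) := by exact_mod_cast hneg
  have : (0 : ℝ) ≤ 2 ^ (2 * (2 * k) - 1) * Real.pi ^ (2 * (2 * k)) * bernoulli (2 * (2 * k)) /
      (2 * (2 * k)).factorial := by positivity
  rw [pow_succ, pow_mul] at hpos
  norm_num [neg_div] at hpos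
  linarith

theorem hCoeff_two_mul {k : ℕ} (hk : k ≠ 0) :
    hCoeff (2 * k) = 2 ^ (4 * k - 1) * cosechCoeff (2 * k) := by
  have hneg := bernoulli_four_mul_neg hk
  obtain ⟨n, hn⟩ : ∃ n, 2 * (2 * k) = n + 1 := ⟨2 * (2 * k) - 1, by omega⟩
  rw [hCoeff, cosechCoeff, coeff_cosechSeries, abs_of_neg hneg,
    show 4 * k - 1 = 2 * (2 * k) - 1 by omega, hn, Nat.add_sub_cancel, pow_succ]
  ring

/-- `ReducesTo p q x` says that the rational number `q` is `p`-integral with reduction `x`. -/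
def ReducesTo (p : ℕ) (q : ℚ) (x : ZMod p) : Prop :=
  ∃ n d : ℤ, (d : ZMod p) ≠ 0 ∧ q * d = n ∧ x * d = n

namespace ReducesTo

variable {p : ℕ} {q r : ℚ} {x y : ZMod p}

theorem intCast [Fact p.Prime] (n : ℤ) : ReducesTo p n n :=
  ⟨n, 1, by simp, by simp, by simp⟩

theorem add [Fact p.Prime] (hq : ReducesTo p q x) (hr : ReducesTo p r y) :
    ReducesTo p (q + r) (x + y) := by
  obtain ⟨n, d, hd, hqd, hxd⟩ := hq
  obtain ⟨m, e, he, hre, hye⟩ := hr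
  refine ⟨n * e + m * d, d * e, ?_, ?_, ?_⟩
  · push_cast
    exact mul_ne_zero hd he
  · push_cast
    linear_combination (e : ℚ) * hqd + (d : ℚ) * hre
  · push_cast
    linear_combination (e : ZMod p) * hxd + (d : ZMod p) * hye

theorem mul [Fact p.Prime] (hq : ReducesTo p q x) (hr : ReducesTo p r y) :
    ReducesTo p (q * r) (x * y) := by
  obtain ⟨n, d, hd, hqd, hxd⟩ := hq
  obtain ⟨m, e, he, hre, hye⟩ := hr
  refine ⟨n * m, d * e, ?_, ?_, ?_⟩
  · push_cast
    exact mul_ne_zero hd he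
  · push_cast
    linear_combination r * e * hqd + (n : ℚ) * hre
  · push_cast
    linear_combination y * e * hxd + (n : ZMod p) * hye

theorem neg (hq : ReducesTo p q x) : ReducesTo p (-q) (-x) := by
  obtain ⟨n, d, hd, hqd, hxd⟩ := hq
  refine ⟨-n, d, hd, ?_, ?_⟩
  · push_cast
    linear_combination -hqd
  · push_cast
    linear_combination -hxd

theorem of_mul_intCast [Fact p.Prime] {c : ℤ} (hc : (c : ZMod p) ≠ 0)
    (h : ReducesTo p (q * c) (x * c)) : ReducesTo p q x := by
  obtain ⟨n, d, hd, hqd, hxd⟩ := h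
  refine ⟨n, c * d, ?_, ?_, ?_⟩
  · push_cast
    exact mul_ne_zero hc hd
  · push_cast
    linear_combination hqd
  · push_cast
    linear_combination hxd

theorem unique [Fact p.Prime] (hx : ReducesTo p q x) (hy : ReducesTo p q y) : x = y := by
  obtain ⟨n, d, hd, hqd, hxd⟩ := hx
  obtain ⟨m, e, he, hqe, hye⟩ := hy
  have h : n * e = m * d := by
    have : (n : ℚ) * e = m * d := by linear_combination (d : ℚ) * hqe - (e : ℚ) * hqd
    exact_mod_cast this
  have h' : (n : ZMod p) * e = m * d := by exact_mod_cast congrArg (Int.cast : ℤ → ZMod p) h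
  have h0 : (x - y) * (d * e) = 0 := by
    linear_combination (e : ZMod p) * hxd - (d : ZMod p) * hye + h'
  exact sub_eq_zero.1 ((mul_eq_zero.1 h0).resolve_right (mul_ne_zero hd he))

end ReducesTo

/-- Horner evaluation with multipliers `(2j+2)(2j+3), (2j+4)(2j+5), …`. -/
def oddFactorialHorner {R : Type*} [CommSemiring R] : ℕ → R → List R → R
  | _, acc, [] => acc
  | j, acc, x :: xs =>
    oddFactorialHorner (j + 1) (acc * ((2 * j + 2) * (2 * j + 3) : ℕ) + x) xs

/-- `oddFactorialHorner` with reduction modulo `p` at each step. -/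
def oddFactorialHornerMod (p : ℕ) : ℕ → ℕ → List ℕ → ℕ
  | _, acc, [] => acc
  | j, acc, x :: xs =>
    oddFactorialHornerMod p (j + 1) ((acc * ((2 * j + 2) * (2 * j + 3)) + x) % p) xs

/-- The list `cosechCoeff (n - 1), …, cosechCoeff 0`. -/
noncomputable def cosechCoeffs : ℕ → List ℚ
  | 0 => []
  | n + 1 => cosechCoeff n :: cosechCoeffs n

theorem length_cosechCoeffs (n : ℕ) : (cosechCoeffs n).length = n := by
  induction n with
  | zero => rfl
  | succ n ih => simp [cosechCoeffs, ih]

theorem oddFactorialHorner_cosechCoeffs (n j : ℕ) (acc : ℚ) :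
    oddFactorialHorner j acc (cosechCoeffs n) / ((2 * (j + n) + 1).factorial : ℚ) =
      acc / ((2 * j + 1).factorial : ℚ) +
        ∑ i ∈ Finset.range n, cosechCoeff i / ((2 * (j + n - i) + 1).factorial : ℚ) := by
  induction n generalizing j acc with
  | zero => simp [cosechCoeffs, oddFactorialHorner]
  | succ n ih =>
    have hfac : ((2 * (j + 1) + 1).factorial : ℚ) =
        (2 * j + 3) * (2 * j + 2) * (2 * j + 1).factorial := by
      rw [show 2 * (j + 1) + 1 = 2 * j + 1 + 1 + 1 by ring, Nat.factorial_succ, Nat.factorial_succ]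
      push_cast
      ring
    have hne : ((2 * j + 1).factorial : ℚ) ≠ 0 := by positivity
    have h := ih (j + 1) (acc * ((2 * j + 2) * (2 * j + 3) : ℕ) + cosechCoeff n)
    rw [cosechCoeffs, oddFactorialHorner, show j + (n + 1) = j + 1 + n by ring, h,
      Finset.sum_range_succ, show j + 1 + n - n = j + 1 by omega, add_div, hfac]
    push_cast
    field_simp
    ring

theorem oddFactorialHorner_cosechCoeff_eq_zero {n : ℕ} (hn : n ≠ 0) :
    oddFactorialHorner 0 (cosechCoeff n) (cosechCoeffs n) = 0 := by
  have h := oddFactorialHorner_cosechCoeffs n 0 (cosechCoeff n)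
  have hs := sum_cosechCoeff_div_factorial hn
  rw [Finset.sum_range_succ] at hs
  simp only [zero_add, Nat.sub_self, mul_zero] at h hs
  rw [add_comm (cosechCoeff n / _), hs, div_eq_zero_iff] at h
  exact h.resolve_right (by positivity)

theorem oddFactorialHorner_eq_mul_add {R : Type*} [CommSemiring R] (xs : List R) (j : ℕ) (acc : R) :
    oddFactorialHorner j acc xs =
      acc * ((2 * j + 2).ascFactorial (2 * xs.length) : ℕ) + oddFactorialHorner j 0 xs := by
  induction xs generalizing j acc with
  | nil => simp [oddFactorialHorner]
  | cons x xs ih =>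
    have hfac : (2 * j + 2).ascFactorial (2 * (xs.length + 1)) =
        (2 * j + 2) * (2 * j + 3) * (2 * (j + 1) + 2).ascFactorial (2 * xs.length) := by
      rw [show 2 * (xs.length + 1) = 2 * xs.length + 1 + 1 by ring, Nat.ascFactorial_succ,
        ← Nat.succ_ascFactorial, Nat.ascFactorial_succ, ← Nat.succ_ascFactorial, mul_assoc]
      rfl
    rw [oddFactorialHorner, oddFactorialHorner, ih, ih (j + 1) (0 * _ + x), List.length_cons, hfac]
    push_cast
    ring

theorem ReducesTo.oddFactorialHorner {p : ℕ} [Fact p.Prime] {qs : List ℚ} {xs : List (ZMod p)}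
    (h : List.Forall₂ (ReducesTo p) qs xs) (j : ℕ) {q : ℚ} {x : ZMod p} (hq : ReducesTo p q x) :
    ReducesTo p (_root_.oddFactorialHorner j q qs) (_root_.oddFactorialHorner j x xs) := by
  induction h generalizing j q x with
  | nil => exact hq
  | cons hr _ ih =>
    refine ih (j + 1) (.add (.mul hq ?_) hr)
    exact_mod_cast ReducesTo.intCast (p := p) (((2 * j + 2) * (2 * j + 3) : ℕ) : ℤ)

theorem natCast_oddFactorialHornerMod (p : ℕ) (xs : List ℕ) (j acc : ℕ) :
    (oddFactorialHornerMod p j acc xs : ZMod p) =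
      oddFactorialHorner j (acc : ZMod p) (xs.map (Nat.cast : ℕ → ZMod p)) := by
  induction xs generalizing j acc with
  | nil => rfl
  | cons x xs ih =>
    rw [oddFactorialHornerMod, ih, List.map_cons, oddFactorialHorner, ZMod.natCast_mod]
    push_cast
    rfl

/-- Check that a list consists of the residues modulo `p` of `cosechCoeff n, …, cosechCoeff 0`. -/
def checkCosechResidues (p : ℕ) : List ℕ → Bool
  | [] => true
  | [x] => x == 1
  | x :: y :: ys => oddFactorialHornerMod p 0 x (y :: ys) % p == 0 && checkCosechResidues p (y :: ys)

theorem reducesTo_of_checkCosechResidues {p : ℕ} [Fact p.Prime] (xs : List ℕ)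
    (hlen : 2 * xs.length ≤ p) (h : checkCosechResidues p xs = true) :
    List.Forall₂ (ReducesTo p) (cosechCoeffs xs.length) (xs.map (Nat.cast : ℕ → ZMod p)) := by
  induction xs with
  | nil => exact .nil
  | cons x ys ih =>
    cases ys with
    | nil =>
      have hx : x = 1 := by simpa [checkCosechResidues] using h
      subst hx
      refine .cons ?_ .nil
      rw [cosechCoeff_zero]
      exact_mod_cast ReducesTo.intCast (p := p) 1
    | cons y ys =>
      rw [checkCosechResidues, Bool.and_eq_true, beq_iff_eq] at h
      have htail := ih (by simp only [List.length_cons] at hlen ⊢; omega) h.2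
      refine .cons ?_ htail
      have hzero := (ZMod.natCast_eq_zero_iff _ p).2 (Nat.dvd_of_mod_eq_zero h.1)
      rw [natCast_oddFactorialHornerMod] at hzero
      generalize hzs : y :: ys = zs at *
      have hne : zs.length ≠ 0 := by simp [← hzs]
      have hq0 := oddFactorialHorner_cosechCoeff_eq_zero hne
      have hq := oddFactorialHorner_eq_mul_add (cosechCoeffs zs.length) 0 (cosechCoeff zs.length)
      have hx := oddFactorialHorner_eq_mul_add (zs.map (Nat.cast : ℕ → ZMod p)) 0 (x : ZMod p)
      rw [hq0, length_cosechCoeffs] at hq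
      rw [hzero, List.length_map] at hx
      have hfac : (2 * 0 + 2).ascFactorial (2 * zs.length) = (2 * zs.length + 1).factorial := by
        simpa [add_comm] using Nat.factorial_mul_ascFactorial 1 (2 * zs.length)
      rw [hfac] at hq hx
      have hr : ReducesTo p _ _ := (ReducesTo.oddFactorialHorner htail 0 (.intCast 0)).neg
      refine .of_mul_intCast (c := ((2 * zs.length + 1).factorial : ℤ)) ?_ ?_
      · rw [Int.cast_natCast, Ne, ZMod.natCast_eq_zero_iff, (Fact.out : p.Prime).dvd_factorial]
        simp only [List.length_cons] at hlen
        omega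
      · push_cast at hr ⊢
        rwa [eq_neg_of_add_eq_zero_left hq.symm, eq_neg_of_add_eq_zero_left hx.symm]

instance fact_prime_1693 : Fact (Nat.Prime 1693) := ⟨by norm_num⟩

/-- The residues modulo `1693` of `cosechCoeff 256, …, cosechCoeff 0`. -/
def cosechResidues : List ℕ :=
  [1575, 812, 287, 4, 978, 1602, 247, 1635, 1196, 125, 618, 1117, 213, 1267, 953, 941, 1692,
   564, 1156, 878, 713, 300, 38, 628, 524, 537, 418, 1507, 510, 333, 740, 1290, 941, 372, 229,
   732, 1531, 362, 858, 1040, 1191, 485, 378, 1556, 495, 1466, 494, 1341, 1476, 127, 645,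
   1146, 161, 1013, 320, 499, 1329, 596, 1003, 1575, 308, 1306, 800, 610, 529, 1219, 452,
   1577, 663, 539, 70, 1560, 45, 398, 203, 206, 639, 475, 1036, 1424, 3, 1047, 736, 10, 486,
   604, 839, 1413, 455, 400, 783, 168, 265, 719, 1430, 924, 1270, 1237, 810, 656, 1396, 1332,
   1546, 1636, 1104, 1175, 1098, 54, 395, 371, 202, 770, 87, 1409, 992, 815, 137, 757, 295,
   259, 1459, 1201, 422, 289, 294, 286, 962, 1466, 490, 59, 316, 711, 158, 505, 1502, 740,
   1170, 1467, 389, 694, 1226, 1325, 870, 1498, 123, 808, 486, 1083, 1271, 915, 1253, 828,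
   1382, 254, 230, 1205, 985, 1447, 1293, 298, 198, 516, 1243, 347, 1357, 1667, 1131, 329,
   1024, 1483, 1423, 1330, 816, 1148, 644, 71, 1259, 1287, 272, 1571, 143, 1187, 484, 1312,
   395, 1005, 1667, 1256, 992, 1298, 619, 1002, 75, 824, 881, 1057, 334, 1054, 1560, 1479,
   444, 1286, 1445, 586, 295, 900, 1591, 1561, 315, 146, 1351, 1462, 1139, 1679, 1149, 1476,
   999, 1412, 1093, 1478, 33, 895, 751, 317, 1572, 1303, 510, 1326, 1097, 727, 258, 937, 1068,
   153, 1622, 1125, 547, 776, 1103, 626, 27, 1108, 610, 1160, 323, 17, 302, 261, 549, 1537,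
   70, 1394, 658, 854, 475, 282, 1]

set_option maxRecDepth 100000 in
theorem checkCosechResidues_cosechResidues : checkCosechResidues 1693 cosechResidues = true := by
  decide +kernel

theorem getElem?_cosechCoeffs {n i : ℕ} (hi : i < n) :
    (cosechCoeffs n)[n - 1 - i]? = some (cosechCoeff i) := by
  induction n with
  | zero => omega
  | succ n ih =>
    rcases Nat.lt_succ_iff_lt_or_eq.1 hi with h | rfl
    · rw [show n + 1 - 1 - i = n - 1 - i + 1 by omega, cosechCoeffs, List.getElem?_cons_succ, ih h]
    · simp [cosechCoeffs]

theorem reducesTo_cosechCoeff {i a : ℕ} (hi : i ≤ 256) (ha : cosechResidues[256 - i]? = some a) :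
    ReducesTo 1693 (cosechCoeff i) (a : ZMod 1693) := by
  have hlen : cosechResidues.length = 257 := by decide +kernel
  have h := reducesTo_of_checkCosechResidues (p := 1693) cosechResidues (by rw [hlen]; norm_num)
    checkCosechResidues_cosechResidues
  rw [hlen] at h
  obtain ⟨h₁, hq⟩ := List.getElem?_eq_some_iff.1 (getElem?_cosechCoeffs (show i < 257 by omega))
  obtain ⟨h₂, hx⟩ := List.getElem?_eq_some_iff.1 ha
  have := h.get h₁ (by simpa using h₂)
  simp only [List.get_eq_getElem, List.getElem_map] at this
  rwa [hq, show cosechResidues[257 - 1 - i] = a from hx] at this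

theorem no_eta_of_jacobiSym_eq_neg_one {k : ℕ} (a b : ℕ) (hk : k ≠ 0) (hk' : k ≤ 128)
    (ha : cosechResidues[256 - k]? = some a) (hb : cosechResidues[256 - 2 * k]? = some b)
    (hJ : jacobiSym (2 ^ (4 * k - 1) * (a ^ 2 - b) * (6 * (2 ^ (4 * k - 1) * b) + 1)) 1693 = -1) :
    ¬ ∃ η : ℤ, (η : ℚ) ^ 2 * (2 * hCoeff k ^ 2 - hCoeff (2 * k)) = 6 * hCoeff (2 * k) + 1 := by
  rintro ⟨η, hη⟩
  have hra := reducesTo_cosechCoeff (by omega) ha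
  have hrb := reducesTo_cosechCoeff (by omega) hb
  have hpow : (2 : ℚ) * 2 ^ (4 * k - 2) = 2 ^ (4 * k - 1) := by
    rw [← pow_succ', show 4 * k - 2 + 1 = 4 * k - 1 by omega]
  rw [hCoeff_sq hk, hCoeff_two_mul hk, ← mul_assoc, hpow] at hη
  have hc := ReducesTo.intCast (p := 1693) (2 ^ (4 * k - 1))
  have hL := (ReducesTo.intCast (p := 1693) (η ^ 2)).mul
    ((hc.mul (hra.mul hra)).add (hc.mul hrb).neg)
  have hR := ((ReducesTo.intCast (p := 1693) 6).mul (hc.mul hrb)).add (.intCast 1)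
  have heq := hL.unique (y := _) (by
    convert hR using 1
    push_cast
    linear_combination hη)
  apply ZMod.nonsquare_of_jacobiSym_eq_neg_one hJ
  refine ⟨η * (2 ^ (4 * k - 1) * (a ^ 2 - b)), ?_⟩
  push_cast at heq ⊢
  linear_combination -(2 ^ (4 * k - 1) * ((a : ZMod 1693) ^ 2 - b)) * heq

set_option exponentiation.threshold 600 in
/-- For every `k ∈ {1, 2, 4, 8, 16, 32, 64, 128}` there is no integer `η` with
`η² * (2 * h_k² - h_{2k}) = 6 * h_{2k} + 1`. -/
theorem no_eta_small_powers_of_two :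
    ∀ k ∈ ({1, 2, 4, 8, 16, 32, 64, 128} : Finset ℕ),
      ¬ ∃ η : ℤ, (η : ℚ) ^ 2 * (2 * hCoeff k ^ 2 - hCoeff (2 * k)) = 6 * hCoeff (2 * k) + 1 := by
  intro k hk
  have hcases : k = 1 ∨ k = 2 ∨ k = 4 ∨ k = 8 ∨ k = 16 ∨ k = 32 ∨ k = 64 ∨ k = 128 := by
    simpa using hk
  rcases hcases with rfl | rfl | rfl | rfl | rfl | rfl | rfl | rfl
  · exact no_eta_of_jacobiSym_eq_neg_one 282 475 (by norm_num) (by norm_num) rfl rfl (by norm_num)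
  · exact no_eta_of_jacobiSym_eq_neg_one 475 658 (by norm_num) (by norm_num) rfl rfl (by norm_num)
  · exact no_eta_of_jacobiSym_eq_neg_one 658 549 (by norm_num) (by norm_num) rfl rfl (by norm_num)
  · exact no_eta_of_jacobiSym_eq_neg_one 549 27 (by norm_num) (by norm_num) rfl rfl (by norm_num)
  · exact no_eta_of_jacobiSym_eq_neg_one 27 1572 (by norm_num) (by norm_num) rfl rfl (by norm_num)
  · exact no_eta_of_jacobiSym_eq_neg_one 1572 75 (by norm_num) (by norm_num) rfl rfl (by norm_num)
  · exact no_eta_of_jacobiSym_eq_neg_one 75 490 (by norm_num) (by norm_num) rfl rfl (by norm_num)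
  · exact no_eta_of_jacobiSym_eq_neg_one 490 1575 (by norm_num) (by norm_num) rfl rfl (by norm_num)
end
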